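/- Let X ⊂ ℝ^d be finite with |X| = n, let η > 0 and S ⊆ X, and let X_m be a random subsample of m points drawn independently and uniformly with replacement from X. Then the probability that there exist u, v ∈ X_m ∩ S with d_MM(u,v;X_m) − d_MM(u,v;X) > η is at most n³·exp(−m·⌈η/d_{g(S)}⌉/n), where d_{g(S)} = max_{x,y∈S} d_MM(x,y;X). -/

import Mathlib

open scoped Classical
open Real

noncomputable section

variable {P : Type*} [MetricSpace P]

/-- The maximum distance between consecutive points of a list (`0` for lists of length `≤ 1`). -/
def pathCost (p : List P) : ℝ := ((p.zip p.tail).map fun q => dist q.1 q.2).foldr max 0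

/-- Min-max (bottleneck) distance between `x` and `y` within the finite set `X`. -/
def minMaxD (X : Finset P) (x y : P) : ℝ :=
  sInf { r | ∃ p : List P, p ≠ [] ∧ p.Nodup ∧ (∀ a ∈ p, a ∈ X) ∧
    p.head? = some x ∧ p.getLast? = some y ∧ r = pathCost p }

/-- `d_MM(S; X) = max_{x,y ∈ S} d_MM(x,y;X)`. -/
def minMaxSet (X : Finset P) (S : Set P) : ℝ :=
  sSup { r | ∃ x ∈ S, ∃ y ∈ S, r = minMaxD X x y }

/-- The set of points appearing in a sample `ω` of `m` draws from `X`. -/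
def sampleFinset {m : ℕ} (X : Finset P) (ω : Fin m → {x // x ∈ X}) : Finset P :=
  Finset.image (fun i => (ω i : P)) Finset.univ

/-- Probability of an event under the uniform distribution on a finite type.  For
`α = Fin m → {x // x ∈ X}` this is the law of `m` points drawn independently and uniformly
with replacement from `X`. -/
def unifProb {α : Type*} [Fintype α] (E : Set α) : ℝ :=
  ((Finset.univ.filter fun a => a ∈ E).card : ℝ) / (Fintype.card α : ℝ)

theorem pathCost_cons_cons (a b : P) (l : List P) :
    pathCost (a :: b :: l) = max (dist a b) (pathCost (b :: l)) := rfl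

theorem pathCost_nonneg (p : List P) : 0 ≤ pathCost p := by
  induction p with
  | nil => exact le_rfl
  | cons a l ih =>
    cases l with
    | nil => exact le_rfl
    | cons b l => rw [pathCost_cons_cons]; exact ih.trans (le_max_right _ _)

theorem pathCost_le_iff {p : List P} {r : ℝ} (hr : 0 ≤ r) :
    pathCost p ≤ r ↔ p.IsChain (fun a b => dist a b ≤ r) := by
  induction p with
  | nil => simpa [pathCost] using hr
  | cons a l ih =>
    cases l with
    | nil => simpa [pathCost] using hr
    | cons b l => rw [pathCost_cons_cons, max_le_iff, List.isChain_cons_cons, ih]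

theorem pathCost_mem (X : Finset P) (p : List P) (hp : ∀ a ∈ p, a ∈ X) :
    pathCost p ∈ insert 0 ((X ×ˢ X).image fun q => dist q.1 q.2) := by
  induction p with
  | nil => simp [pathCost]
  | cons a l ih =>
    cases l with
    | nil => simp [pathCost]
    | cons b l =>
      rw [pathCost_cons_cons]
      rcases max_choice (dist a b) (pathCost (b :: l)) with h | h <;> rw [h]
      · refine Finset.mem_insert_of_mem (Finset.mem_image.2 ⟨(a, b), ?_, rfl⟩)
        exact Finset.mem_product.2 ⟨hp a (by simp), hp b (by simp)⟩
      · exact ih fun c hc => hp c (List.mem_cons_of_mem _ hc)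

theorem minMaxD_le_pathCost {X : Finset P} {x y : P} {p : List P} (hne : p ≠ [])
    (hnd : p.Nodup) (hX : ∀ a ∈ p, a ∈ X) (hx : p.head? = some x) (hy : p.getLast? = some y) :
    minMaxD X x y ≤ pathCost p := by
  refine csInf_le ⟨0, ?_⟩ ⟨p, hne, hnd, hX, hx, hy, rfl⟩
  rintro r ⟨q, -, -, -, -, -, rfl⟩
  exact pathCost_nonneg q

/-- The infimum defining the min-max distance is attained. -/
theorem exists_pathCost_eq_minMaxD {X : Finset P} {x y : P} (hx : x ∈ X) (hy : y ∈ X) :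
    ∃ p : List P, p ≠ [] ∧ p.Nodup ∧ (∀ a ∈ p, a ∈ X) ∧
      p.head? = some x ∧ p.getLast? = some y ∧ minMaxD X x y = pathCost p := by
  suffices h : minMaxD X x y ∈ { r | ∃ p : List P, p ≠ [] ∧ p.Nodup ∧ (∀ a ∈ p, a ∈ X) ∧
      p.head? = some x ∧ p.getLast? = some y ∧ r = pathCost p } from h
  refine Set.Nonempty.csInf_mem ?_ ?_
  · by_cases h : x = y
    · subst h
      exact ⟨_, [x], by simp, by simp, by simpa using hx, rfl, rfl, rfl⟩
    · exact ⟨_, [x, y], by simp, by simpa using h, by simp [hx, hy], rfl, rfl, rfl⟩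
  · refine Set.Finite.subset
      (Finset.finite_toSet (insert 0 ((X ×ˢ X).image fun q => dist q.1 q.2))) ?_
    rintro r ⟨q, -, -, hq, -, -, rfl⟩
    exact pathCost_mem X q hq

theorem minMaxD_nonneg (X : Finset P) (x y : P) : 0 ≤ minMaxD X x y := by
  refine Real.sInf_nonneg ?_
  rintro r ⟨q, -, -, -, -, -, rfl⟩
  exact pathCost_nonneg q

theorem minMaxD_le_minMaxSet (X S : Finset P) {x y : P} (hx : x ∈ S) (hy : y ∈ S) :
    minMaxD X x y ≤ minMaxSet X ↑S := by
  refine le_csSup (Set.Finite.bddAbove ?_) ⟨x, hx, y, hy, rfl⟩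
  refine ((S ×ˢ S).finite_toSet.image fun q => minMaxD X q.1 q.2).subset ?_
  rintro r ⟨a, ha, b, hb, rfl⟩
  exact ⟨(a, b), by simpa using ⟨ha, hb⟩, rfl⟩

theorem dist_le_of_isChain {δ : ℝ} (a b : P) (q : List P)
    (h : (a :: (q ++ [b])).IsChain fun x y => dist x y ≤ δ) :
    dist a b ≤ (q.length + 1 : ℕ) * δ := by
  induction q generalizing a with
  | nil => simpa using h
  | cons c q ih =>
    rw [List.cons_append, List.isChain_cons_cons] at h
    have h2 := ih c h.2
    have h3 := dist_triangle a c b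
    push_cast [List.length_cons] at h2 ⊢
    linarith [h.1]

theorem isChain_cons_filter {δ : ℝ} (hδ : 0 ≤ δ) (k : ℕ) (Y : Finset P) (l : List P) (a : P)
    (q : List P) (h : (a :: (q ++ l)).IsChain fun x y => dist x y ≤ δ) (hq : ∀ c ∈ q, c ∉ Y)
    (hk : ∀ s, s <:+: q ++ l → (∀ c ∈ s, c ∉ Y) → s.length < k) :
    (a :: l.filter (· ∈ Y)).IsChain fun x y => dist x y ≤ k * δ := by
  induction l generalizing a q with
  | nil => simp
  | cons b l ih =>
    have happ : q ++ b :: l = (q ++ [b]) ++ l := by simp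
    by_cases hb : b ∈ Y
    · rw [List.filter_cons_of_pos (by simpa using hb), List.isChain_cons_cons]
      constructor
      · have h1 : (a :: (q ++ [b])).IsChain fun x y => dist x y ≤ δ := by
          rw [happ, ← List.cons_append] at h
          exact h.left_of_append
        refine (dist_le_of_isChain a b q h1).trans ?_
        have : q.length < k := hk q (List.prefix_append _ _).isInfix hq
        exact mul_le_mul_of_nonneg_right (by exact_mod_cast this) hδ
      · refine ih b [] ?_ (by simp) ?_
        · rw [← List.cons_append] at h
          exact h.right_of_append
        · intro s hs
          refine hk s (hs.trans ?_)
          rw [happ]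
          exact (List.suffix_append _ _).isInfix
    · rw [List.filter_cons_of_neg (by simpa using hb)]
      refine ih a (q ++ [b]) (by rwa [← happ]) ?_ (by rwa [← happ])
      simp only [List.mem_append, List.mem_singleton]
      rintro c (hc | rfl)
      exacts [hq c hc, hb]

/-- If every run of `k` consecutive points of a path meets `Y`, then skipping the points outside
`Y` multiplies the cost of the path by at most `k`. -/
theorem minMaxD_le_mul_pathCost {Y : Finset P} {x y : P} {p : List P} {k : ℕ}
    (hnd : p.Nodup) (hx : p.head? = some x) (hy : p.getLast? = some y) (hxY : x ∈ Y)
    (hyY : y ∈ Y) (hk : ∀ s, s <:+: p → (∀ c ∈ s, c ∉ Y) → s.length < k) :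
    minMaxD Y x y ≤ k * pathCost p := by
  have h0 := pathCost_nonneg p
  have hhead : (p.filter (· ∈ Y)).head? = some x := by
    obtain ⟨t, rfl⟩ := List.head?_eq_some_iff.1 hx
    rw [List.filter_cons_of_pos (by simpa using hxY)]
    rfl
  have hlast : (p.filter (· ∈ Y)).getLast? = some y := by
    obtain ⟨t, rfl⟩ := List.getLast?_eq_some_iff.1 hy
    simp [hyY]
  refine (minMaxD_le_pathCost (p := p.filter (· ∈ Y)) ?_ (hnd.filter _) ?_ hhead hlast).trans ?_
  · intro h
    simp [h] at hhead
  · intro a ha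
    simpa using (List.mem_filter.1 ha).2
  · rw [pathCost_le_iff (by positivity)]
    have hc := (pathCost_le_iff h0).1 (le_refl (pathCost p))
    obtain ⟨t, ht⟩ := List.head?_eq_some_iff.1 hx
    generalize pathCost p = δ at h0 hc ⊢
    subst ht
    rw [List.filter_cons_of_pos (by simpa using hxY)]
    exact isChain_cons_filter h0 k Y t x [] hc (by simp)
      fun s hs => hk s (hs.trans (List.suffix_cons x t).isInfix)

theorem apply_mem_sampleFinset {Q : Type*} {m : ℕ} (X : Finset Q) (ω : Fin m → {x // x ∈ X})
    (i : Fin m) : (ω i : Q) ∈ sampleFinset X ω :=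
  Finset.mem_image_of_mem (fun j => (ω j : Q)) (Finset.mem_univ i)

theorem unifProb_eq_card_div {α : Type*} [Fintype α] {E : Set α} {F : Finset α}
    (h : ∀ a, a ∈ F ↔ a ∈ E) : unifProb E = (F.card : ℝ) / (Fintype.card α : ℝ) := by
  unfold unifProb
  congr 3
  ext a
  simp [h]

theorem unifProb_mono {α : Type*} [Fintype α] {E F : Set α} (h : E ⊆ F) :
    unifProb E ≤ unifProb F := by
  unfold unifProb
  gcongr

theorem unifProb_le_one {α : Type*} [Fintype α] (E : Set α) : unifProb E ≤ 1 :=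
  div_le_one_of_le₀ (by exact_mod_cast Finset.card_filter_le _ _) (by positivity)

theorem unifProb_biUnion_le {α ι : Type*} [Fintype α] (s : Finset ι) (E : ι → Set α) :
    unifProb (⋃ i ∈ s, E i) ≤ ∑ i ∈ s, unifProb (E i) := by
  unfold unifProb
  rw [← Finset.sum_div]
  gcongr
  norm_cast
  refine le_trans (Finset.card_le_card ?_)
    (Finset.card_biUnion_le (s := s) (t := fun i => Finset.univ.filter fun a => a ∈ E i))
  intro a
  simp

/-- The probability that `m` independent uniform draws all miss a given set of points. -/
theorem unifProb_forall_notMem_le {α : Type*} [Fintype α] [Nonempty α] (T : Finset α) (m : ℕ) :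
    unifProb {ω : Fin m → α | ∀ i, ω i ∉ T} ≤
      Real.exp (-(m * (T.card : ℝ)) / Fintype.card α) := by
  have hn : (0 : ℝ) < Fintype.card α := by exact_mod_cast Fintype.card_pos
  have hexp : Real.exp (-(m * (T.card : ℝ)) / Fintype.card α) =
      Real.exp (-(T.card / Fintype.card α : ℝ)) ^ m := by
    rw [← Real.exp_nat_mul]
    congr 1
    ring
  have hle : (T.card : ℝ) ≤ Fintype.card α := by exact_mod_cast T.card_le_univ
  rw [unifProb_eq_card_div (F := Fintype.piFinset fun _ => Tᶜ) (by simp), hexp, Fintype.card_piFinset_const, Fintype.card_fun, Fintype.card_fin,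
    Finset.card_compl]
  push_cast [Nat.cast_sub T.card_le_univ]
  rw [← div_pow, sub_div, div_self hn.ne']
  refine pow_le_pow_left₀ (sub_nonneg.2 ((div_le_one hn).2 hle)) (Real.one_sub_le_exp_neg _) m

/-- For a random subsample `X_m` of `m` points drawn uniformly with replacement
from `X`, the probability that some `u, v ∈ X_m ∩ S` have
`d_MM(u,v;X_m) − d_MM(u,v;X) > η` is at most `n³·exp(−m·⌈η/d_{g(S)}⌉/n)`,
where `d_{g(S)} = max_{x,y∈S} d_MM(x,y;X)`. -/
theorem stmt8 {d : ℕ} (X : Finset (EuclideanSpace ℝ (Fin d))) (n : ℕ) (hn : X.card = n)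
    (η : ℝ) (hη : 0 < η) (S : Finset (EuclideanSpace ℝ (Fin d))) (hS : S ⊆ X) (m : ℕ) :
    unifProb { ω : Fin m → {x // x ∈ X} |
        ∃ u ∈ sampleFinset X ω ∩ S, ∃ v ∈ sampleFinset X ω ∩ S,
          η < minMaxD (sampleFinset X ω) u v - minMaxD X u v } ≤
      (n : ℝ) ^ 3 *
        Real.exp (-(m * (⌈η / minMaxSet X ↑S⌉₊ : ℝ)) / n) := by
  rcases X.eq_empty_or_nonempty with rfl | hXne
  · obtain rfl := Finset.subset_empty.1 hS
    rw [← hn]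
    simp [unifProb]
  have hnpos : 1 ≤ n := hn ▸ hXne.card_pos
  have : Nonempty {x // x ∈ X} := hXne.to_subtype
  have hcard : Fintype.card {x // x ∈ X} = n := by simpa using hn
  have hD0 : 0 ≤ minMaxSet X (S : Set (EuclideanSpace ℝ (Fin d))) := by
    refine Real.sSup_nonneg ?_
    rintro r ⟨x, -, y, -, rfl⟩
    exact minMaxD_nonneg X x y
  have hDle := fun x y => minMaxD_le_minMaxSet X S (x := x) (y := y)
  generalize minMaxSet X (S : Set (EuclideanSpace ℝ (Fin d))) = D at hD0 hDle ⊢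
  rcases hD0.eq_or_lt with rfl | hD
  · refine (unifProb_le_one _).trans ?_
    have : (1 : ℝ) ≤ n := by exact_mod_cast hnpos
    simpa using one_le_pow₀ this
  set k := ⌈η / D⌉₊ with hkdef
  have hkpos : 0 < k := Nat.ceil_pos.2 (by positivity)
  have hpath : ∀ u v, ∃ p : List (EuclideanSpace ℝ (Fin d)), u ∈ X → v ∈ X →
      p.Nodup ∧ (∀ a ∈ p, a ∈ X) ∧ p.head? = some u ∧ p.getLast? = some v ∧
        minMaxD X u v = pathCost p := by
    intro u v
    by_cases h : u ∈ X ∧ v ∈ X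
    · obtain ⟨p, -, hp⟩ := exists_pathCost_eq_minMaxD h.1 h.2
      exact ⟨p, fun _ _ => hp⟩
    · exact ⟨[], fun hu hv => absurd ⟨hu, hv⟩ h⟩
  choose path hpath using hpath
  -- the runs of `k` consecutive points on the chosen optimal paths
  let run : ({x // x ∈ X} × {x // x ∈ X}) × Fin n → Finset {x // x ∈ X} := fun t =>
    (((path t.1.1 t.1.2).drop t.2).take k).toFinset.subtype (· ∈ X)
  let runs : Finset (({x // x ∈ X} × {x // x ∈ X}) × Fin n) :=
    Finset.univ.filter fun t => (run t).card = k
  have hruns : (runs.card : ℝ) ≤ (n : ℝ) ^ 3 := by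
    have : runs.card ≤ (n * n) * n := by
      refine (Finset.card_filter_le _ _).trans ?_
      rw [Finset.card_univ, Fintype.card_prod, Fintype.card_prod, hcard, Fintype.card_fin]
    calc (runs.card : ℝ) ≤ ((n * n) * n : ℕ) := by exact_mod_cast this
      _ = (n : ℝ) ^ 3 := by push_cast; ring
  have hsub : { ω : Fin m → {x // x ∈ X} |
        ∃ u ∈ sampleFinset X ω ∩ S, ∃ v ∈ sampleFinset X ω ∩ S,
          η < minMaxD (sampleFinset X ω) u v - minMaxD X u v } ⊆
      ⋃ t ∈ runs, {ω : Fin m → {x // x ∈ X} | ∀ i, ω i ∉ run t} := by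
    rintro ω ⟨u, hu, v, hv, huv⟩
    rw [Finset.mem_inter] at hu hv
    have huX := hS hu.2
    have hvX := hS hv.2
    obtain ⟨hnd, hpX, hhead, hlast, hcost⟩ := hpath u v huX hvX
    obtain ⟨s, hs, hsY, hsk⟩ : ∃ s, s <:+: path u v ∧ (∀ c ∈ s, c ∉ sampleFinset X ω) ∧
        k ≤ s.length := by
      by_contra! hcon
      have h1 := minMaxD_le_mul_pathCost hnd hhead hlast hu.1 hv.1 hcon
      rw [← hcost] at h1
      have hδ := hDle u v hu.2 hv.2
      have hδ0 := minMaxD_nonneg X u v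
      have hk1 : (k : ℝ) < η / D + 1 := Nat.ceil_lt_add_one (by positivity)
      have h2 : k * minMaxD X u v ≤ (η / D + 1) * minMaxD X u v := by gcongr
      have h3 : η / D * minMaxD X u v ≤ η / D * D := by gcongr
      rw [div_mul_cancel₀ _ hD.ne'] at h3
      linarith
    obtain ⟨a, b, hab⟩ := hs
    have hlen : (path u v).length ≤ n := by
      rw [← hn, ← List.toFinset_card_of_nodup hnd]
      exact Finset.card_le_card fun c hc => hpX c (List.mem_toFinset.1 hc)
    have halt : a.length < n := by
      have := congrArg List.length hab
      simp only [List.length_append] at this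
      omega
    have htake : ((path u v).drop a.length).take k = s.take k := by
      rw [← hab, List.append_assoc, List.drop_left, List.take_append_of_le_length hsk]
    have hsX : ∀ c ∈ s.take k, c ∈ X := fun c hc =>
      hpX c (hab ▸ by simp [List.mem_of_mem_take hc])
    refine Set.mem_biUnion (x := ((⟨u, huX⟩, ⟨v, hvX⟩), ⟨a.length, halt⟩)) ?_ ?_
    · simp only [runs, run, Finset.coe_filter, Finset.mem_univ, true_and, Set.mem_ofPred_eq, htake]
      rw [Finset.card_subtype, Finset.filter_true_of_mem (by simpa using hsX),
        List.toFinset_card_of_nodup, List.length_take, min_eq_left hsk]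
      rw [← hab] at hnd
      exact (hnd.of_append_left.of_append_right).sublist (List.take_sublist _ _)
    · intro i hi
      simp only [run, htake, Finset.mem_subtype, List.mem_toFinset] at hi
      exact hsY _ (List.mem_of_mem_take hi) (apply_mem_sampleFinset X ω i)
  calc _ ≤ _ := unifProb_mono hsub
    _ ≤ ∑ t ∈ runs, unifProb {ω : Fin m → {x // x ∈ X} | ∀ i, ω i ∉ run t} :=
      unifProb_biUnion_le _ _
    _ ≤ ∑ _t ∈ runs, Real.exp (-(m * (k : ℝ)) / n) := by
      refine Finset.sum_le_sum fun t ht => ?_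
      have h := unifProb_forall_notMem_le (run t) m
      rwa [(Finset.mem_filter.1 ht).2, hcard] at h
    _ = runs.card * Real.exp (-(m * (k : ℝ)) / n) := by rw [Finset.sum_const, nsmul_eq_mul]
    _ ≤ _ := by gcongr
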